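/- arXiv:1507.07488 — 3 statements merged into one kernel-verified Lean document; each statement's English description precedes it below -/
import Mathlib

section
/- Let A, Ā, B, B̄ ∈ R and set a = A − Ā, b = B − B̄. Then [a₋, B] + [a₊, B̄] − [b₋, A] − [b₊, Ā] = ([A, B] − [Ā, B̄]) − [a₊, b₊] + [a₋, b₋]. (This is the key algebraic identity in the proof of Lemma 3.1 of 'Additional symmetries of the extended bigraded Toda hierarchy', computing the commutator of the vector fields ∂*_a and ∂*_b on the wave operator W.) -/
/-- Let `R` be an associative (not necessarily commutative) ring, and
`π₊, π₋ : R → R` additive group endomorphisms with `π₊ + π₋ = id`.  For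
`A, Ā, B, B̄ ∈ R`, setting `a = A − Ā` and `b = B − B̄`, we have
`[a₋, B] + [a₊, B̄] − [b₋, A] − [b₊, Ā]
  = ([A, B] − [Ā, B̄]) − [a₊, b₊] + [a₋, b₋]`,
where `[x, y] = x*y − y*x`. -/
theorem stmt0 {R : Type*} [Ring R] (pp pm : R →+ R)
    (hsum : pp + pm = AddMonoidHom.id R)
    (A Abar B Bbar a b : R) (ha : a = A - Abar) (hb : b = B - Bbar) :
    ⁅pm a, B⁆ + ⁅pp a, Bbar⁆ - ⁅pm b, A⁆ - ⁅pp b, Abar⁆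
      = (⁅A, B⁆ - ⁅Abar, Bbar⁆) - ⁅pp a, pp b⁆ + ⁅pm a, pm b⁆ := by
  have hA : Abar = A - (pp a + pm a) := by
    rw [← AddMonoidHom.add_apply, hsum, AddMonoidHom.id_apply, ha, sub_sub_cancel]
  have hB : Bbar = B - (pp b + pm b) := by
    rw [← AddMonoidHom.add_apply, hsum, AddMonoidHom.id_apply, hb, sub_sub_cancel]
  clear ha hb
  generalize pp a = p, pm a = m, pp b = q, pm b = n at *
  subst hA hB
  simp only [Ring.lie_def]
  noncomm_ring
end

section
/- For every integer p ≥ 0 and every integer n ≥ 1, the commutator [∂_{t_n}, D_p] of ℚ-linear endomorphisms of R equals: (n/k)·∂_{t_{(p−1)k+n}} if p ≥ 1, or if p = 0 and n > k; (n(k−n)/k)·(multiplication by t_{k−n}) if p = 0 and n < k; multiplication by x_0 if p = 0 and n = k. -/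
open MvPolynomial

noncomputable section

namespace EBTH

/-- Variables of the polynomial ring: `x n` for `n ≥ 0`, `t n` and `tb n` ("t-bar")
for `n ≥ 1` (indexed by positive naturals). -/
inductive Var : Type
  | x : ℕ → Var
  | t : {n : ℕ // 0 < n} → Var
  | tb : {n : ℕ // 0 < n} → Var
  deriving DecidableEq

/-- The polynomial algebra `R = ℚ[x₀, x₁, …; t₁, t₂, …; t̄₁, t̄₂, …]`. -/
abbrev P : Type := MvPolynomial Var ℚ

/-- The variable `t n`; intended (and only used) for `n ≥ 1`. -/
def tv (n : ℕ) : Var := Var.t ⟨max n 1, by omega⟩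

/-- The variable `t̄ n`; intended (and only used) for `n ≥ 1`. -/
def tbv (n : ℕ) : Var := Var.tb ⟨max n 1, by omega⟩

/-- Multiplication by a polynomial, as a `ℚ`-linear endomorphism. -/
def mul (f : P) : Module.End ℚ P := LinearMap.mulLeft ℚ f

/-- The partial derivative `∂_v`, as a `ℚ`-linear endomorphism. -/
def pd (v : Var) : Module.End ℚ P := (MvPolynomial.pderiv v).toLinearMap

/-- The commutator `[P,Q] = PQ − QP` of endomorphisms. -/
def comm (f g : Module.End ℚ P) : Module.End ℚ P := f * g - g * f

/-- The first-order (locally finite) part of `D₀`, i.e. the derivation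
`(1/k)·Σ_{n≥1}( x_{n+1}·∂_{t_{nk}} + (n+k)·t_{n+k}·∂_{t_n} )
 + (1/m)·Σ_{n≥1}( x_{n+1}·∂_{t̄_{nm}} + (n+m)·t̄_{n+m}·∂_{t̄_n} )
 + Σ_{n≥1} n·x_n·∂_{x_{n−1}}`,
encoded by its values on the variables. -/
def D0der (k m : ℕ) : Module.End ℚ P :=
  (mkDerivation ℚ fun v => match v with
    | Var.x j => ((j : ℚ) + 1) • X (Var.x (j + 1))
    | Var.t j => (((j : ℚ) + k) / k) • X (tv ((j : ℕ) + k))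
        + (if k ∣ (j : ℕ) then (1 / (k : ℚ)) • X (Var.x ((j : ℕ) / k + 1)) else 0)
    | Var.tb j => (((j : ℚ) + m) / m) • X (tbv ((j : ℕ) + m))
        + (if m ∣ (j : ℕ) then (1 / (m : ℚ)) • X (Var.x ((j : ℕ) / m + 1)) else 0)
  ).toLinearMap

/-- The zero-order part of `D₀`: the polynomial
`(1/(2k))·Σ_{n=1}^{k−1} n(k−n)·t_n t_{k−n} + (1/(2m))·Σ_{n=1}^{m−1} n(m−n)·t̄_n t̄_{m−n}
 + (1/k + 1/m)·x₀x₁ + x₀(t_k + t̄_m)`. -/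
def Q0 (k m : ℕ) : P :=
  (1 / (2 * (k : ℚ))) • (∑ i ∈ Finset.range (k - 1),
      (((i : ℚ) + 1) * ((k : ℚ) - ((i : ℚ) + 1))) • (X (tv (i + 1)) * X (tv (k - (i + 1)))))
  + (1 / (2 * (m : ℚ))) • (∑ i ∈ Finset.range (m - 1),
      (((i : ℚ) + 1) * ((m : ℚ) - ((i : ℚ) + 1))) • (X (tbv (i + 1)) * X (tbv (m - (i + 1)))))
  + ((1 / (k : ℚ)) + (1 / (m : ℚ))) • (X (Var.x 0) * X (Var.x 1))
  + X (Var.x 0) * (X (tv k) + X (tbv m))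

/-- The first-order part of `D₁`, i.e. the derivation
`(1/k)·Σ_{n≥1}( x_n·∂_{t_{nk}} + n·t_n·∂_{t_n} )
 + (1/m)·Σ_{n≥1}( x_n·∂_{t̄_{nm}} + n·t̄_n·∂_{t̄_n} ) + Σ_{n≥1} n·x_n·∂_{x_n}`. -/
def D1der (k m : ℕ) : Module.End ℚ P :=
  (mkDerivation ℚ fun v => match v with
    | Var.x j => (j : ℚ) • X (Var.x j)
    | Var.t j => ((j : ℚ) / k) • X (Var.t j)
        + (if k ∣ (j : ℕ) then (1 / (k : ℚ)) • X (Var.x ((j : ℕ) / k)) else 0)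
    | Var.tb j => ((j : ℚ) / m) • X (Var.tb j)
        + (if m ∣ (j : ℕ) then (1 / (m : ℚ)) • X (Var.x ((j : ℕ) / m)) else 0)
  ).toLinearMap

/-- The first-order part of `D_{p+1}` for `p ≥ 1`, i.e. the derivation
`Σ_{n≥1} n·x_n·∂_{x_{p+n}} + (1/k)·Σ_{n≥0}( x_n·∂_{t_{(p+n)k}} + n·t_n·∂_{t_{pk+n}} )
 + (1/m)·Σ_{n≥0}( x_n·∂_{t̄_{(p+n)m}} + n·t̄_n·∂_{t̄_{pm+n}} )`. -/
def Dbigder (k m p : ℕ) : Module.End ℚ P :=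
  (mkDerivation ℚ fun v => match v with
    | Var.x j => if p < j then ((j : ℚ) - (p : ℚ)) • X (Var.x (j - p)) else 0
    | Var.t j =>
        (if k ∣ (j : ℕ) ∧ p ≤ (j : ℕ) / k then
            (1 / (k : ℚ)) • X (Var.x ((j : ℕ) / k - p)) else 0)
        + (if p * k < (j : ℕ) then
            (((j : ℚ) - (p : ℚ) * k) / k) • X (tv ((j : ℕ) - p * k)) else 0)
    | Var.tb j =>
        (if m ∣ (j : ℕ) ∧ p ≤ (j : ℕ) / m then
            (1 / (m : ℚ)) • X (Var.x ((j : ℕ) / m - p)) else 0)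
        + (if p * m < (j : ℕ) then
            (((j : ℚ) - (p : ℚ) * m) / m) • X (tbv ((j : ℕ) - p * m)) else 0)
  ).toLinearMap

/-- The second-order part of `D_{p+1}` for `p ≥ 1`:
`(1/(2k))·Σ_{n=1}^{pk−1} ∂_{t_n}∂_{t_{pk−n}} + (1/(2m))·Σ_{n=1}^{pm−1} ∂_{t̄_n}∂_{t̄_{pm−n}}`. -/
def Dbig2 (k m p : ℕ) : Module.End ℚ P :=
  (1 / (2 * (k : ℚ))) • (∑ i ∈ Finset.range (p * k - 1),
      pd (tv (i + 1)) * pd (tv (p * k - (i + 1))))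
  + (1 / (2 * (m : ℚ))) • (∑ i ∈ Finset.range (p * m - 1),
      pd (tbv (i + 1)) * pd (tbv (p * m - (i + 1))))

/-- The operators `D_p` (`p ≥ 0`) from Section 4.4 of the paper. -/
def D (k m : ℕ) : ℕ → Module.End ℚ P
  | 0 => D0der k m + mul (Q0 k m)
  | 1 => D1der k m
      + mul (((1 / (2 * (k : ℚ))) + (1 / (2 * (m : ℚ)))) • (X (Var.x 0) * X (Var.x 0)))
  | (p + 2) => Dbigder k m (p + 1) + Dbig2 k m (p + 1)

/-- The subalgebra `F = ℚ[x₁, x₂, …]` of polynomials involving none of the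
variables `x₀, t_n, t̄_n`. -/
def Fsub : Subalgebra ℚ P := Algebra.adjoin ℚ (Set.range fun n : ℕ => X (Var.x (n + 1)))

end EBTH

namespace EBTH

theorem comm_add (f g h : Module.End ℚ P) : comm f (g + h) = comm f g + comm f h := by
  simp only [comm, mul_add, add_mul]
  abel

theorem comm_pd_mul (v : Var) (q : P) : comm (pd v) (mul q) = mul (pderiv v q) := by
  refine LinearMap.ext fun a => ?_
  simp [comm, pd, mul, mul_comm, Derivation.leibniz]

theorem comm_pd_pd (v w : Var) : comm (pd v) (pd w) = 0 := by
  have h : ⁅(pderiv v : Derivation ℚ P P), (pderiv w : Derivation ℚ P P)⁆ = 0 := by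
    refine derivation_ext fun u => ?_
    simp [Derivation.commutator_apply, pderiv_X, Pi.single_apply, apply_ite]
  exact congrArg (fun d : Derivation ℚ P P => (d : Module.End ℚ P)) h

theorem commute_pd_pd (v w : Var) : Commute (pd v) (pd w) :=
  sub_eq_zero.1 (comm_pd_pd v w)

theorem comm_pd_mkDerivation (v u : Var) (f : Var → P) (c : ℚ)
    (hf : ∀ w, pderiv v (f w) = if w = u then C c else 0) :
    comm (pd v) (mkDerivation ℚ f).toLinearMap = c • pd u := by
  have h : ⁅(pderiv v : Derivation ℚ P P), mkDerivation ℚ f⁆ = c • pderiv u := by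
    refine derivation_ext fun w => ?_
    rw [Derivation.commutator_apply, mkDerivation_X, hf, pderiv_X, Derivation.smul_apply,
      pderiv_X]
    simp only [Pi.single_apply, smul_eq_C_mul]
    split_ifs <;> simp
  exact congrArg (fun d : Derivation ℚ P P => (d : Module.End ℚ P)) h

theorem comm_pd_mkDerivation_eq_zero (v : Var) (f : Var → P) (hf : ∀ w, pderiv v (f w) = 0) :
    comm (pd v) (mkDerivation ℚ f).toLinearMap = 0 := by
  simpa using comm_pd_mkDerivation v v f 0 (by simpa using hf)

theorem comm_pd_Dbig2 (k m p : ℕ) (v : Var) : comm (pd v) (Dbig2 k m p) = 0 := by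
  refine sub_eq_zero.2 (Commute.eq ?_)
  unfold Dbig2
  refine Commute.add_right (Commute.smul_right (Commute.sum_right _ _ _ fun i _ => ?_) _)
    (Commute.smul_right (Commute.sum_right _ _ _ fun i _ => ?_) _) <;>
  exact (commute_pd_pd _ _).mul_right (commute_pd_pd _ _)

theorem x_ne_tv (j n : ℕ) : Var.x j ≠ tv n := by
  simp [tv]

theorem tb_ne_tv (j : {n : ℕ // 0 < n}) (n : ℕ) : Var.tb j ≠ tv n := by
  simp [tv]

theorem pderiv_tv_x (n j : ℕ) : pderiv (tv n) (X (Var.x j) : P) = 0 :=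
  pderiv_X_of_ne (x_ne_tv j n)

theorem pderiv_tv_tb (n : ℕ) (j : {n : ℕ // 0 < n}) :
    pderiv (tv n) (X (Var.tb j) : P) = 0 :=
  pderiv_X_of_ne (tb_ne_tv j n)

theorem pderiv_tv_tbv (n j : ℕ) : pderiv (tv n) (X (tbv j) : P) = 0 :=
  pderiv_tv_tb n _

theorem t_eq_tv_iff {n : ℕ} (hn : 1 ≤ n) (j : {n : ℕ // 0 < n}) :
    Var.t j = tv n ↔ (j : ℕ) = n := by
  simp [tv, Subtype.ext_iff, max_eq_left hn]

theorem tv_eq_tv_iff {n j : ℕ} (hn : 1 ≤ n) (hj : 1 ≤ j) : tv j = tv n ↔ j = n := by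
  simp [tv, max_eq_left hn, max_eq_left hj]

theorem pderiv_tv_t {n : ℕ} (hn : 1 ≤ n) (j : {n : ℕ // 0 < n}) :
    pderiv (tv n) (X (Var.t j) : P) = if (j : ℕ) = n then 1 else 0 := by
  simp [pderiv_X, Pi.single_apply, t_eq_tv_iff hn]

theorem pderiv_tv_tv {n j : ℕ} (hn : 1 ≤ n) (hj : 1 ≤ j) :
    pderiv (tv n) (X (tv j) : P) = if j = n then 1 else 0 := by
  simp [pderiv_X, Pi.single_apply, tv_eq_tv_iff hn hj]

theorem comm_pd_D0der_of_lt {k n : ℕ} (m : ℕ) (hn : k < n) :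
    comm (pd (tv n)) (D0der k m) = ((n : ℚ) / k) • pd (tv (n - k)) := by
  refine comm_pd_mkDerivation _ _ _ _ fun w => ?_
  rcases w with j | j | j
  · simp [x_ne_tv, -pderiv_X]
  · have hj := j.2
    have h : (j : ℕ) + k = n ↔ (j : ℕ) = n - k := by omega
    rw [map_add, Derivation.map_smul, apply_ite (pderiv (tv n)), Derivation.map_smul, pderiv_tv_x,
      pderiv_tv_tv (by omega) (by omega)]
    simp only [t_eq_tv_iff (show 1 ≤ n - k by omega)]
    by_cases hjn : (j : ℕ) + k = n
    · rw [if_pos hjn, if_pos (h.1 hjn), ← hjn]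
      simp [smul_eq_C_mul]
    · simp [hjn, mt h.2 hjn]
  · simp [pderiv_tv_x, pderiv_tv_tbv, apply_ite (pderiv (tv n)), tb_ne_tv, -pderiv_X]

theorem comm_pd_D0der_of_le {k n : ℕ} (m : ℕ) (hn : 1 ≤ n) (hnk : n ≤ k) :
    comm (pd (tv n)) (D0der k m) = 0 := by
  refine comm_pd_mkDerivation_eq_zero _ _ fun w => ?_
  rcases w with j | j | j
  · simp [pderiv_tv_x, -pderiv_X]
  · have hj := j.2
    have h : (j : ℕ) + k ≠ n := by omega
    simp [pderiv_tv_x, pderiv_tv_tv hn (show 1 ≤ (j : ℕ) + k by omega), h,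
      apply_ite (pderiv (tv n)), -pderiv_X]
  · simp [pderiv_tv_x, pderiv_tv_tbv, apply_ite (pderiv (tv n)), -pderiv_X]

theorem comm_pd_D1der {n : ℕ} (k m : ℕ) (hn : 1 ≤ n) :
    comm (pd (tv n)) (D1der k m) = ((n : ℚ) / k) • pd (tv n) := by
  refine comm_pd_mkDerivation _ _ _ _ fun w => ?_
  rcases w with j | j | j
  · simp [x_ne_tv, -pderiv_X]
  · rw [map_add, Derivation.map_smul, apply_ite (pderiv (tv n)), Derivation.map_smul, pderiv_tv_x,
      pderiv_tv_t hn]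
    simp only [t_eq_tv_iff hn]
    by_cases hjn : (j : ℕ) = n
    · simp [hjn, smul_eq_C_mul]
    · simp [hjn]
  · simp [pderiv_tv_x, apply_ite (pderiv (tv n)), tb_ne_tv, -pderiv_X]

theorem comm_pd_Dbigder {n : ℕ} (k m p : ℕ) (hn : 1 ≤ n) :
    comm (pd (tv n)) (Dbigder k m p) = ((n : ℚ) / k) • pd (tv (p * k + n)) := by
  refine comm_pd_mkDerivation _ _ _ _ fun w => ?_
  rcases w with j | j | j
  · simp [apply_ite (pderiv (tv n)), x_ne_tv, -pderiv_X]
  · rw [map_add, apply_ite (pderiv (tv n)), apply_ite (pderiv (tv n)), Derivation.map_smul, Derivation.map_smul,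
      pderiv_tv_x]
    simp only [t_eq_tv_iff (show 1 ≤ p * k + n by omega)]
    by_cases hlt : p * k < (j : ℕ)
    · rw [if_pos hlt, pderiv_tv_tv hn (by omega)]
      by_cases hjn : (j : ℕ) = p * k + n
      · simp [hjn, smul_eq_C_mul]
      · have h : (j : ℕ) - p * k ≠ n := by omega
        simp [hjn, h]
    · have h : (j : ℕ) ≠ p * k + n := by omega
      simp [hlt, h]
  · simp [pderiv_tv_x, pderiv_tv_tbv, apply_ite (pderiv (tv n)), tb_ne_tv, -pderiv_X]

theorem pderiv_Q0_sum {k n : ℕ} (hk : 0 < k) (hn : 1 ≤ n) :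
    pderiv (tv n) ((1 / (2 * (k : ℚ))) • (∑ i ∈ Finset.range (k - 1),
      (((i : ℚ) + 1) * ((k : ℚ) - ((i : ℚ) + 1))) •
        (X (tv (i + 1)) * X (tv (k - (i + 1))) : P))) =
      if n < k then (((n : ℚ) * ((k : ℚ) - (n : ℚ))) / k) • X (tv (k - n)) else 0 := by
  have key : ∀ i ∈ Finset.range (k - 1),
      pderiv (tv n) ((((i : ℚ) + 1) * ((k : ℚ) - ((i : ℚ) + 1))) •
        (X (tv (i + 1)) * X (tv (k - (i + 1))) : P)) =
      (if k - 1 - n = i then (if n < k then ((n : ℚ) * ((k : ℚ) - n)) • X (tv (k - n)) else 0)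
        else 0) +
      (if n - 1 = i then (if n < k then ((n : ℚ) * ((k : ℚ) - n)) • X (tv (k - n)) else 0)
        else (0 : P)) := by
    intro i hi
    rw [Finset.mem_range] at hi
    rw [Derivation.map_smul, Derivation.leibniz, pderiv_tv_tv hn (by omega), pderiv_tv_tv hn (by omega),
      smul_add]
    congr 1
    · by_cases h : k - (i + 1) = n
      · have hnk : n < k := by omega
        have hi' : i + 1 = k - n := by omega
        have hq : (i : ℚ) + 1 = k - n := by
          rw [← Nat.cast_sub hnk.le, ← hi']; push_cast; ring
        rw [if_pos h, if_pos (by omega), if_pos hnk, hi', hq, smul_eq_mul, mul_one]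
        congr 1
        ring
      · rw [if_neg h]
        split_ifs <;> first | omega | simp
    · by_cases h : i + 1 = n
      · have hnk : n < k := by omega
        rw [if_pos h, if_pos (by omega), if_pos hnk, ← h, smul_eq_mul, mul_one]
        push_cast
        rfl
      · rw [if_neg h, if_neg (by omega), smul_zero, smul_zero]
  rw [Derivation.map_smul, map_sum, Finset.sum_congr rfl key, Finset.sum_add_distrib, Finset.sum_ite_eq,
    Finset.sum_ite_eq]
  have hk' : (k : ℚ) ≠ 0 := by positivity
  by_cases hnk : n < k
  · rw [if_pos (Finset.mem_range.2 (by omega)), if_pos (Finset.mem_range.2 (by omega)),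
      if_pos hnk, if_pos hnk, ← add_smul, smul_smul]
    congr 1
    field_simp
    ring
  · simp [hnk]

theorem pderiv_Q0 {k n : ℕ} (m : ℕ) (hk : 0 < k) (hn : 1 ≤ n) :
    pderiv (tv n) (Q0 k m) =
      (if n < k then (((n : ℚ) * ((k : ℚ) - (n : ℚ))) / k) • X (tv (k - n)) else 0) +
      (if k = n then X (Var.x 0) else 0) := by
  rw [Q0, map_add, map_add, map_add, pderiv_Q0_sum hk hn]
  simp [Derivation.leibniz, pderiv_tv_x, pderiv_tv_tbv, pderiv_tv_tv hn hk, -pderiv_X]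

theorem comm_pd_mul_x_zero_sq (n : ℕ) (c : ℚ) :
    comm (pd (tv n)) (mul (c • (X (Var.x 0) * X (Var.x 0)))) = 0 := by
  rw [comm_pd_mul]
  simp [Derivation.leibniz, pderiv_tv_x, mul, -pderiv_X]

end EBTH

open EBTH in
/-- for `p ≥ 0`, `n ≥ 1`, the commutator `[∂_{t_n}, D_p]` equals
`(n/k)·∂_{t_{(p−1)k+n}}` if `p ≥ 1` or (`p = 0` and `n > k`);
`(n(k−n)/k)·(t_{k−n}·)` if `p = 0` and `n < k`; and `(x₀·)` if `p = 0`, `n = k`. -/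
theorem stmt3 (k m : ℕ) (hk : 0 < k) (hm : 0 < m) (p n : ℕ) (hn : 1 ≤ n) :
    ((1 ≤ p ∨ (p = 0 ∧ k < n)) →
      comm (pd (tv n)) (D k m p)
        = ((n : ℚ) / k) • pd (tv ((((p : ℤ) - 1) * k + n).toNat))) ∧
    (p = 0 → n < k →
      comm (pd (tv n)) (D k m p)
        = (((n : ℚ) * ((k : ℚ) - (n : ℚ))) / k) • mul (X (tv (k - n)))) ∧
    (p = 0 → n = k →
      comm (pd (tv n)) (D k m p) = mul (X (Var.x 0))) := by
  refine ⟨?_, ?_, ?_⟩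
  · rintro (hp | ⟨rfl, hkn⟩)
    · obtain _ | _ | p := p
      · omega
      · rw [show ((((0 + 1 : ℕ) : ℤ) - 1) * k + n).toNat = n by simp, D, comm_add,
          comm_pd_D1der k m hn, comm_pd_mul_x_zero_sq, add_zero]
      · have h : ((((p + 1 + 1 : ℕ) : ℤ) - 1) * k + n).toNat = (p + 1) * k + n := by
          rw [← Int.toNat_natCast ((p + 1) * k + n)]
          push_cast
          congr 1
          ring
        rw [h, D, comm_add, comm_pd_Dbigder k m _ hn, comm_pd_Dbig2, add_zero]
    · have h : ((((0 : ℕ) : ℤ) - 1) * k + n).toNat = n - k := by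
        push_cast
        omega
      rw [h, D, comm_add, comm_pd_D0der_of_lt m hkn, comm_pd_mul, pderiv_Q0 m hk hn,
        if_neg (by omega), if_neg (by omega)]
      simp [mul]
  · rintro rfl hnk
    rw [D, comm_add, comm_pd_D0der_of_le m hn hnk.le, comm_pd_mul, pderiv_Q0 m hk hn,
      if_pos hnk, if_neg (by omega), zero_add, add_zero]
    refine LinearMap.ext fun a => ?_
    simp [mul]
  · rintro rfl rfl
    rw [D, comm_add, comm_pd_D0der_of_le m hn le_rfl, comm_pd_mul, pderiv_Q0 m hk hn,
      if_neg (lt_irrefl _), if_pos rfl, zero_add, zero_add]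
end
end

section
/- For every integer p ≥ 0 and every integer n ≥ 1, there exists f ∈ F such that the commutator [D_p, t_n·] of ℚ-linear endomorphisms of R equals: (1/k)·∂_{t_{(p−1)k−n}} + f· if n < (p−1)k; ((n−(p−1)k)/k)·(multiplication by t_{n−(p−1)k}) + f· if n > (p−1)k; (1/k)·(multiplication by x_0) + f· if n = (p−1)k. -/
open MvPolynomial

noncomputable section

namespace EBTH

theorem comm_add_s4 (a b c : Module.End ℚ P) : comm (a + b) c = comm a c + comm b c := by
  simp only [comm, add_mul, mul_add]; abel

theorem comm_smul (r : ℚ) (a c : Module.End ℚ P) : comm (r • a) c = r • comm a c := by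
  simp only [comm, smul_mul_assoc, mul_smul_comm, smul_sub]

theorem comm_sum {ι : Type*} (s : Finset ι) (a : ι → Module.End ℚ P) (c : Module.End ℚ P) :
    comm (∑ i ∈ s, a i) c = ∑ i ∈ s, comm (a i) c := by
  simp only [comm, Finset.sum_mul, Finset.mul_sum, Finset.sum_sub_distrib]

theorem comm_derivation (d : Derivation ℚ P P) (g : P) :
    comm d.toLinearMap (mul g) = mul (d g) := by
  refine LinearMap.ext fun h => ?_
  simp [comm, mul, mul_comm]

theorem comm_mul (f g : P) : comm (mul f) (mul g) = 0 := by
  refine LinearMap.ext fun h => ?_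
  simp only [comm, mul, LinearMap.sub_apply, Module.End.mul_apply, LinearMap.mulLeft_apply,
    LinearMap.zero_apply]
  ring

theorem mul_of_add (f g : P) : mul (f + g) = mul f + mul g := by
  refine LinearMap.ext fun h => ?_
  simp [mul, add_mul]

theorem mul_of_smul (r : ℚ) (f : P) : mul (r • f) = r • mul f := by
  refine LinearMap.ext fun h => ?_
  simp [mul]

theorem mul_of_zero : mul 0 = 0 := by
  refine LinearMap.ext fun h => ?_
  simp [mul]

theorem comm_pd_mul_pd (a b v : Var) :
    comm (pd a * pd b) (mul (X v)) =
      (if v = a then pd b else 0) + (if v = b then pd a else 0) := by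
  have key : comm (pd a * pd b) (mul (X v)) =
      comm (pd a) (mul (X v)) * pd b + pd a * comm (pd b) (mul (X v)) := by
    simp only [comm, sub_mul, mul_sub, mul_assoc]; abel
  have hc (w : Var) : comm (pd w) (mul (X v)) = if v = w then 1 else 0 := by
    rw [pd, comm_derivation, pderiv_X, Pi.single_apply]
    split_ifs
    · exact LinearMap.mulLeft_one ℚ P
    · exact mul_of_zero
  rw [key, hc, hc]
  split_ifs <;> simp

theorem tv_of_pos {n : ℕ} (hn : 0 < n) : tv n = Var.t ⟨n, hn⟩ := by
  simp only [tv, Var.t.injEq, Subtype.mk.injEq]; omega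

theorem tv_inj {a b : ℕ} (ha : 0 < a) (hb : 0 < b) : tv a = tv b ↔ a = b := by
  simp [tv_of_pos ha, tv_of_pos hb]

theorem tv_ne_tbv (a b : ℕ) : tv a ≠ tbv b := by
  simp [tv, tbv]

theorem comm_Dbig2 {k m p n : ℕ} (hn : 0 < n) :
    comm (Dbig2 k m p) (mul (X (tv n))) =
      if n < p * k then (1 / (k : ℚ)) • pd (tv (p * k - n)) else 0 := by
  have hb : comm (∑ i ∈ Finset.range (p * m - 1),
      pd (tbv (i + 1)) * pd (tbv (p * m - (i + 1)))) (mul (X (tv n))) = 0 := by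
    rw [comm_sum]
    refine Finset.sum_eq_zero fun i _ => ?_
    simp [comm_pd_mul_pd, tv_ne_tbv]
  have ht : comm (∑ i ∈ Finset.range (p * k - 1),
      pd (tv (i + 1)) * pd (tv (p * k - (i + 1)))) (mul (X (tv n))) =
      if n < p * k then (2 : ℚ) • pd (tv (p * k - n)) else 0 := by
    rw [comm_sum]
    by_cases hlt : n < p * k
    · have hi : ∀ i ∈ Finset.range (p * k - 1),
          comm (pd (tv (i + 1)) * pd (tv (p * k - (i + 1)))) (mul (X (tv n))) =
          (if n - 1 = i then pd (tv (p * k - n)) else 0) +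
          (if p * k - n - 1 = i then pd (tv (p * k - n)) else 0) := by
        intro i hi
        have := Finset.mem_range.mp hi
        simp only [comm_pd_mul_pd, tv_inj hn (show 0 < i + 1 by omega),
          tv_inj hn (show 0 < p * k - (i + 1) by omega)]
        congr 1
        · by_cases h : n - 1 = i
          · rw [if_pos h, if_pos (by omega), show i + 1 = n by omega]
          · rw [if_neg h, if_neg (by omega)]
        · by_cases h : p * k - n - 1 = i
          · rw [if_pos h, if_pos (by omega), show i + 1 = p * k - n by omega]
          · rw [if_neg h, if_neg (by omega)]
      rw [Finset.sum_congr rfl hi, Finset.sum_add_distrib, Finset.sum_ite_eq, Finset.sum_ite_eq,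
        if_pos (Finset.mem_range.mpr (by omega)), if_pos (Finset.mem_range.mpr (by omega)),
        if_pos hlt, two_smul]
    · rw [if_neg hlt]
      refine Finset.sum_eq_zero fun i hi => ?_
      have := Finset.mem_range.mp hi
      rw [comm_pd_mul_pd, if_neg (by rw [tv_inj hn (by omega)]; omega),
        if_neg (by rw [tv_inj hn (by omega)]; omega), add_zero]
  rw [Dbig2, comm_add_s4, comm_smul, comm_smul, hb, ht]
  split_ifs
  · rw [smul_smul, smul_zero, add_zero]
    congr 1
    rw [one_div, mul_inv]; ring
  · simp

theorem X_mem_Fsub {j : ℕ} (hj : 0 < j) : X (Var.x j) ∈ Fsub :=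
  Algebra.subset_adjoin ⟨j - 1, by simp only [Nat.sub_add_cancel hj]⟩

theorem ite_smul_X_mem_Fsub (c : Prop) [Decidable c] (r : ℚ) {j : ℕ} (hj : c → 0 < j) :
    (if c then r • X (Var.x j) else 0 : P) ∈ Fsub := by
  split_ifs with h
  · exact Fsub.smul_mem (X_mem_Fsub (hj h)) r
  · exact Fsub.zero_mem

end EBTH

open EBTH in
/-- for `p ≥ 0`, `n ≥ 1`, there exists `f ∈ F` such that
`[D_p, t_n·]` equals `(1/k)·∂_{t_{(p−1)k−n}} + f·` if `n < (p−1)k`;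
`((n−(p−1)k)/k)·(t_{n−(p−1)k}·) + f·` if `n > (p−1)k`;
and `(1/k)·(x₀·) + f·` if `n = (p−1)k`. -/
theorem stmt4 (k m : ℕ) (hk : 0 < k) (hm : 0 < m) (p n : ℕ) (hn : 1 ≤ n) :
    ∃ f ∈ Fsub,
      ((n : ℤ) < ((p : ℤ) - 1) * k →
        comm (D k m p) (mul (X (tv n)))
          = (1 / (k : ℚ)) • pd (tv ((((p : ℤ) - 1) * k - n).toNat)) + mul f) ∧
      (((p : ℤ) - 1) * k < (n : ℤ) →
        comm (D k m p) (mul (X (tv n)))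
          = ((((n : ℚ) - ((p : ℚ) - 1) * k)) / k)
              • mul (X (tv (((n : ℤ) - ((p : ℤ) - 1) * k).toNat))) + mul f) ∧
      ((n : ℤ) = ((p : ℤ) - 1) * k →
        comm (D k m p) (mul (X (tv n)))
          = (1 / (k : ℚ)) • mul (X (Var.x 0)) + mul f) := by
  match p with
  | 0 =>
    refine ⟨_, ite_smul_X_mem_Fsub (k ∣ n) (1 / (k : ℚ)) (j := n / k + 1)
      (fun _ => Nat.succ_pos _), fun h => ?_, fun _ => ?_, fun h => ?_⟩
    · push_cast at h; omega
    · rw [D, comm_add_s4, comm_mul, add_zero, D0der, comm_derivation, tv_of_pos hn, mkDerivation_X]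
      simp only [mul_of_add, mul_of_smul]
      rw [show ((n : ℤ) - (((0 : ℕ) : ℤ) - 1) * k).toNat = n + k by push_cast; omega]
      congr 2
      push_cast; ring
    · push_cast at h; omega
  | 1 =>
    refine ⟨_, ite_smul_X_mem_Fsub (k ∣ n) (1 / (k : ℚ)) (j := n / k)
      (fun h => Nat.div_pos (Nat.le_of_dvd hn h) hk), fun h => ?_, fun _ => ?_, fun h => ?_⟩
    · push_cast at h; omega
    · rw [D, comm_add_s4, comm_mul, add_zero, D1der, comm_derivation, tv_of_pos hn, mkDerivation_X]
      simp only [mul_of_add, mul_of_smul]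
      rw [show ((n : ℤ) - (((1 : ℕ) : ℤ) - 1) * k).toNat = n by push_cast; omega, tv_of_pos hn]
      congr 2
      push_cast; ring
    · push_cast at h; omega
  | p + 2 =>
    have hq : (((p + 2 : ℕ) : ℤ) - 1) * k = (((p + 1) * k : ℕ) : ℤ) := by push_cast; ring
    have hq' : (((p + 2 : ℕ) : ℚ) - 1) * k = ((p + 1 : ℕ) : ℚ) * k := by push_cast; ring
    have hD : comm (D k m (p + 2)) (mul (X (tv n))) =
        mul (if k ∣ n ∧ p + 1 ≤ n / k then
            (1 / (k : ℚ)) • X (Var.x (n / k - (p + 1))) else 0)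
        + mul (if (p + 1) * k < n then
            (((n : ℚ) - ((p + 1 : ℕ) : ℚ) * k) / k) • X (tv (n - (p + 1) * k)) else 0)
        + if n < (p + 1) * k then (1 / (k : ℚ)) • pd (tv ((p + 1) * k - n)) else 0 := by
      rw [D, comm_add_s4, comm_Dbig2 hn, Dbigder, comm_derivation, ← mul_of_add]
      nth_rw 1 [tv_of_pos hn]
      rw [mkDerivation_X]
    rw [hq, hq', hD]
    rcases lt_trichotomy n ((p + 1) * k) with h | h | h
    · refine ⟨0, Fsub.zero_mem, fun _ => ?_, fun h' => ?_, fun h' => ?_⟩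
      · rw [if_neg fun hc => absurd ((Nat.le_div_iff_mul_le hk).mp hc.2) (by omega),
          if_neg (by omega), if_pos h, mul_of_zero, zero_add, zero_add, add_zero,
          show ((((p + 1) * k : ℕ) : ℤ) - n).toNat = (p + 1) * k - n by omega]
      · omega
      · omega
    · refine ⟨0, Fsub.zero_mem, fun h' => ?_, fun h' => ?_, fun _ => ?_⟩
      · omega
      · omega
      · have hd : n / k = p + 1 := by rw [h, Nat.mul_div_cancel _ hk]
        rw [if_pos ⟨⟨p + 1, by rw [h, mul_comm]⟩, hd.ge⟩, if_neg (by omega), if_neg (by omega),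
          hd, Nat.sub_self, mul_of_zero, mul_of_smul, add_zero]
    · refine ⟨_, ite_smul_X_mem_Fsub (k ∣ n ∧ p + 1 ≤ n / k) (1 / (k : ℚ))
        (j := n / k - (p + 1)) ?_, fun h' => ?_, fun _ => ?_, fun h' => ?_⟩
      · rintro ⟨⟨c, rfl⟩, -⟩
        rw [Nat.mul_div_cancel_left _ hk]
        rw [mul_comm k c] at h
        exact Nat.sub_pos_of_lt (lt_of_mul_lt_mul_right h k.zero_le)
      · omega
      · rw [if_pos h, if_neg (show ¬ n < (p + 1) * k by omega), mul_of_smul, add_zero, add_comm,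
          show ((n : ℤ) - (((p + 1) * k : ℕ) : ℤ)).toNat = n - (p + 1) * k by omega]
      · omega
end
end
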